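/- arXiv:1204.6075 — 3 statements merged into one kernel-verified Lean document; each statement's English description precedes it below -/
import Mathlib

section
/- Let Q be a loop with the right inverse property (RIP), let J denote the inversion map, and let σ be a permutation of Q. Then σ is a middle pseudoautomorphism of Q with companion c if and only if σ is a right pseudoautomorphism of Q with companion c. -/
/-- A loop: a quasigroup (with left division `ldiv` and right division `rdiv`)
with a two-sided identity element. -/
class NLoop (Q : Type*) extends Mul Q, One Q where
  /-- left division: `ldiv a b = a \ b` -/
  ldiv : Q → Q → Q
  /-- right division: `rdiv b a = b / a` -/
  rdiv : Q → Q → Q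
  mul_ldiv : ∀ a b : Q, a * ldiv a b = b
  ldiv_mul : ∀ a b : Q, ldiv a (a * b) = b
  rdiv_mul : ∀ a b : Q, rdiv a b * b = a
  mul_rdiv : ∀ a b : Q, rdiv (a * b) b = a
  one_mul : ∀ a : Q, 1 * a = a
  mul_one : ∀ a : Q, a * 1 = a

/-- A loop with two-sided inverses. -/
class NInvLoop (Q : Type*) extends NLoop Q, Inv Q where
  mul_inv : ∀ a : Q, a * a⁻¹ = 1
  inv_mul : ∀ a : Q, a⁻¹ * a = 1

/-- `(α, β, γ)` is an autotopism: `xα · yβ = (x·y)γ`. -/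
def IsAutotopism {Q : Type*} [NLoop Q] (α β γ : Q → Q) : Prop :=
  ∀ x y : Q, α x * β y = γ (x * y)

/-- `σ` is an automorphism. -/
def IsAutomorphism {Q : Type*} [NLoop Q] (σ : Q → Q) : Prop :=
  ∀ x y : Q, σ (x * y) = σ x * σ y

/-- `β` is a left pseudoautomorphism with companion `a`. -/
def IsLeftPseudo {Q : Type*} [NLoop Q] (β : Q → Q) (a : Q) : Prop :=
  ∀ x y : Q, a * β (x * y) = (a * β x) * β y

/-- `γ` is a middle pseudoautomorphism with companion `c`. -/
def IsMiddlePseudo {Q : Type*} [NLoop Q] (γ : Q → Q) (c : Q) : Prop :=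
  ∀ x y : Q, γ (x * y) = NLoop.rdiv (γ x) (NLoop.ldiv c 1) * NLoop.ldiv c (γ y)

/-- `α` is a right pseudoautomorphism with companion `b`. -/
def IsRightPseudo {Q : Type*} [NLoop Q] (α : Q → Q) (b : Q) : Prop :=
  ∀ x y : Q, α (x * y) * b = α x * (α y * b)

namespace NInvLoop

variable {Q : Type*} [NInvLoop Q]

theorem left_cancel {a x y : Q} (h : a * x = a * y) : x = y := by
  rw [← NLoop.ldiv_mul a x, h, NLoop.ldiv_mul]

theorem right_cancel {a x y : Q} (h : x * a = y * a) : x = y := by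
  rw [← NLoop.mul_rdiv x a, h, NLoop.mul_rdiv]

theorem ldiv_one (a : Q) : NLoop.ldiv a 1 = a⁻¹ := by
  rw [← mul_inv a, NLoop.ldiv_mul]

theorem rdiv_inv_of_rip (rip : ∀ x y : Q, (x * y) * y⁻¹ = x) (x y : Q) :
    NLoop.rdiv x y⁻¹ = x * y :=
  right_cancel ((NLoop.rdiv_mul x y⁻¹).trans (rip x y).symm)

/-- Under the right inverse property, an autotopism `(α, β, γ)` yields the
autotopism `(γ, JβJ, α)`, where `J` is the inversion map. -/
theorem isAutotopism_of_rip (rip : ∀ x y : Q, (x * y) * y⁻¹ = x) {α β γ : Q → Q}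
    (h : IsAutotopism α β γ) : IsAutotopism γ (fun y => (β y⁻¹)⁻¹) α := by
  intro x y
  have hxy := h (x * y) y⁻¹
  rw [rip] at hxy
  rw [← hxy, rip]

end NInvLoop

/-- In a loop with the right inverse property, a permutation `σ` is
a middle pseudoautomorphism with companion `c` iff it is a right
pseudoautomorphism with companion `c`. -/
theorem stmt_12 (Q : Type*) [NInvLoop Q]
    (rip : ∀ x y : Q, (x * y) * y⁻¹ = x)
    (σ : Equiv.Perm Q) (c : Q) :
    IsMiddlePseudo (⇑σ) c ↔ IsRightPseudo (⇑σ) c := by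
  have hmid : IsMiddlePseudo σ c ↔ IsAutotopism (fun x => σ x * c)
      (fun y => NLoop.ldiv c (σ y)) σ := by
    simp only [IsMiddlePseudo, IsAutotopism, NInvLoop.ldiv_one,
      NInvLoop.rdiv_inv_of_rip rip, eq_comm]
  rw [hmid]
  constructor
  · intro h
    have h1 : σ 1 = 1 := by
      have hc : NLoop.ldiv c (σ 1) = c⁻¹ := by
        have hx := h 1 1
        rw [NLoop.mul_one] at hx
        exact NInvLoop.left_cancel (hx.trans (rip (σ 1) c).symm)
      rw [← NLoop.mul_ldiv c (σ 1), hc, NInvLoop.mul_inv]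
    have h' := NInvLoop.isAutotopism_of_rip rip h
    intro x y
    have hy := h' 1 y
    simp only [h1, NLoop.one_mul] at hy
    rw [← hy]
    exact (h' x y).symm
  · intro h
    have h1 : σ 1 = 1 := by
      have hx := h 1 1
      rw [NLoop.mul_one] at hx
      exact NInvLoop.right_cancel
        ((NInvLoop.left_cancel hx).symm.trans (NLoop.one_mul c).symm)
    have h' := NInvLoop.isAutotopism_of_rip rip
      (α := σ) (β := fun y => σ y * c) (γ := fun x => σ x * c)
      (fun x y => (h x y).symm)
    intro x y
    have hy := h' 1 y
    simp only [h1, NLoop.one_mul] at hy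
    beta_reduce
    rw [← hy, NLoop.ldiv_mul]
    exact h' x y
end

section
/- In a loop Q with two-sided inverses satisfying the WCIP, the middle nucleus equals the right nucleus: N_μ(Q) = N_ρ(Q). -/
theorem NInvLoop.inv_inv {Q : Type*} [NInvLoop Q] (a : Q) : a⁻¹⁻¹ = a := by
  rw [← NLoop.ldiv_mul a⁻¹ a⁻¹⁻¹, mul_inv, ← inv_mul a, NLoop.ldiv_mul]

/-- In a WCIP loop, a middle nuclear element is right nuclear. -/
theorem NInvLoop.right_nuclear_of_middle_nuclear {Q : Type*} [NInvLoop Q]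
    (wcip : ∀ x y : Q, (x * y)⁻¹ * y = x⁻¹) {c : Q}
    (hc : ∀ x y : Q, (x * c) * y = x * (c * y)) (x y : Q) :
    (x * y) * c = x * (y * c) := by
  have key : ∀ x y : Q, (x * y) * c = x * (c * y) := fun x y => by
    have h := wcip (x * y * c)⁻¹ (c * y)
    rw [← hc (x * y * c)⁻¹ y, wcip, wcip, inv_inv, inv_inv] at h
    exact h.symm
  have comm : y * c = c * y := by simpa only [NLoop.one_mul] using key 1 y
  rw [key, comm]

/-- In a WCIP loop, a right nuclear element is middle nuclear. -/
theorem NInvLoop.middle_nuclear_of_right_nuclear {Q : Type*} [NInvLoop Q]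
    (wcip : ∀ x y : Q, (x * y)⁻¹ * y = x⁻¹) {c : Q}
    (hc : ∀ x y : Q, (x * y) * c = x * (y * c)) (x y : Q) :
    (x * c) * y = x * (c * y) := by
  have key : ∀ u y : Q, (u * c) * y = u * (y * c) := fun u y => by
    have h := wcip ((u * (y * c))⁻¹ * y) c
    rw [hc, wcip, inv_inv] at h
    rw [h, wcip, inv_inv]
  have comm : c * y = y * c := by simpa only [NLoop.one_mul] using key 1 y
  rw [key, comm]

/-- In a WCIP loop with two-sided inverses, the middle nucleus
equals the right nucleus. -/
theorem stmt_13 (Q : Type*) [NInvLoop Q]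
    (wcip : ∀ x y : Q, (x * y)⁻¹ * y = x⁻¹) :
    {c : Q | ∀ x y : Q, (x * c) * y = x * (c * y)} =
      {b : Q | ∀ x y : Q, (x * y) * b = x * (y * b)} := by
  ext c
  exact ⟨NInvLoop.right_nuclear_of_middle_nuclear wcip,
    NInvLoop.middle_nuclear_of_right_nuclear wcip⟩
end

section
/- Let Q be a loop with two-sided inverses satisfying the WCIP whose left nucleus is trivial (N_λ(Q) = {1}). Then every right pseudoautomorphism of Q is an automorphism. If, in addition, every element of Q has a unique square root (the map x ↦ x·x is a bijection of Q), then every left pseudoautomorphism of Q is an automorphism. -/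
namespace NLoop

variable {Q : Type*} [NLoop Q] {a b : Q}

theorem eq_one_of_mul_eq_left (h : a * b = a) : b = 1 := by
  rw [← ldiv_mul a b, h, ← ldiv_mul a 1, mul_one]

theorem eq_one_of_mul_eq_right (h : a * b = b) : a = 1 := by
  rw [← mul_rdiv a b, h, ← mul_rdiv 1 b, one_mul]

end NLoop

namespace NInvLoop

variable {Q : Type*} [NInvLoop Q]

theorem inv_inv' (a : Q) : a⁻¹⁻¹ = a := by
  rw [← NLoop.mul_rdiv a⁻¹⁻¹ a⁻¹, inv_mul, ← mul_inv a, NLoop.mul_rdiv]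

theorem inv_one' : (1 : Q)⁻¹ = 1 := by
  rw [← NLoop.one_mul (1 : Q)⁻¹, mul_inv]

end NInvLoop

namespace IsAutotopism

/-- In a loop with trivial left nucleus, the first component of an autotopism
is determined by the second one. -/
theorem fst_unique {Q : Type*} [NLoop Q]
    (htriv : ∀ a : Q, (∀ x y : Q, (a * x) * y = a * (x * y)) → a = 1)
    {α β γ α' γ' : Q → Q} (h : IsAutotopism α β γ) (h' : IsAutotopism α' β γ')
    (hα : Function.Surjective α) (hγ : Function.Injective γ) (x : Q) : α' x = α x := by
  choose F hF using fun x => hα (α' x)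
  have key : ∀ x y, γ (F x * y) = γ' (x * y) := fun x y => by
    rw [← h, hF, h']
  have hF_mul : ∀ x y, F x * y = F (x * y) := fun x y => hγ <| by
    rw [key, ← NLoop.mul_one (F (x * y)), key, NLoop.mul_one]
  have hF_one : ∀ y, F 1 * y = F y := fun y => by rw [hF_mul, NLoop.one_mul]
  have h1 : F 1 = 1 := htriv _ fun x y => by rw [hF_one, hF_one, hF_mul]
  rw [← hF, ← hF_one, h1, NLoop.one_mul]

/-- In a loop with the weak commutative inverse property, conjugating the outer components of an
autotopism by inversion and swapping them gives an autotopism. -/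
theorem inv_swap {Q : Type*} [NInvLoop Q] (wcip : ∀ x y : Q, (x * y)⁻¹ * y = x⁻¹)
    {α β γ : Q → Q} (h : IsAutotopism α β γ) :
    IsAutotopism (fun x => (γ x⁻¹)⁻¹) β (fun x => (α x⁻¹)⁻¹) := fun x y => by
  change (γ x⁻¹)⁻¹ * β y = (α (x * y)⁻¹)⁻¹
  rw [← wcip x y, ← h, wcip]

end IsAutotopism

/-- Corollary: In a WCIP loop with two-sided inverses and trivial
left nucleus, every right pseudoautomorphism is an automorphism; if moreover
squaring is a bijection, every left pseudoautomorphism is an automorphism. -/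
theorem stmt_16 (Q : Type*) [NInvLoop Q]
    (wcip : ∀ x y : Q, (x * y)⁻¹ * y = x⁻¹)
    (htriv : ∀ a : Q, (∀ x y : Q, (a * x) * y = a * (x * y)) → a = 1) :
    (∀ (σ : Equiv.Perm Q) (c : Q), IsRightPseudo (⇑σ) c → IsAutomorphism (⇑σ)) ∧
    (Function.Bijective (fun x : Q => x * x) →
      ∀ (σ : Equiv.Perm Q) (c : Q), IsLeftPseudo (⇑σ) c → IsAutomorphism (⇑σ)) := by
  refine ⟨fun σ c h => ?_, fun hsq σ a h => ?_⟩
  · have hat : IsAutotopism σ (fun y => σ y * c) (fun y => σ y * c) := fun x y => (h x y).symm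
    have hinj : Function.Injective fun y => σ y * c := fun x y hxy => σ.injective <| by
      simpa only [NLoop.mul_rdiv] using congrArg (NLoop.rdiv · c) hxy
    have key := hat.fst_unique htriv (hat.inv_swap wcip) σ.surjective hinj 1
    have hσ : σ 1 = 1 := NLoop.eq_one_of_mul_eq_right <| by
      rw [← h 1 1, NLoop.one_mul]
    have hc : c = 1 := by
      rw [NInvLoop.inv_one', hσ, NLoop.one_mul] at key
      rw [← NInvLoop.inv_inv' c, key, NInvLoop.inv_one']
    intro x y
    simpa only [hc, NLoop.mul_one] using h x y
  · have hat : IsAutotopism (fun x => a * σ x) σ (fun x => a * σ x) := fun x y => (h x y).symm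
    have hinj : Function.Injective fun x => a * σ x := fun x y hxy => σ.injective <| by
      simpa only [NLoop.ldiv_mul] using congrArg (NLoop.ldiv a) hxy
    have hsurj : Function.Surjective fun x => a * σ x := fun b =>
      ⟨σ.symm (NLoop.ldiv a b), by simp only [Equiv.apply_symm_apply, NLoop.mul_ldiv]⟩
    have key := hat.fst_unique htriv (hat.inv_swap wcip) hsurj hinj 1
    have hσ : σ 1 = 1 := NLoop.eq_one_of_mul_eq_left <| by
      rw [← h 1 1, NLoop.one_mul]
    have ha : a = 1 := hsq.injective <| by
      simp only [NInvLoop.inv_one', hσ, NLoop.mul_one] at key ⊢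
      rw [← NInvLoop.mul_inv a, key]
    intro x y
    simpa only [ha, NLoop.one_mul] using h x y
end
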